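/- Let p be an odd prime, k and ℓ positive integers, q = p^k, Q = p^ℓ, and c = (c0,c1,c2,c3) ∈ F_{q²}⁴. Assume there is no λ ∈ F_{q²} with B(X) = λ·A(X) (so B/A is a non-constant rational function), and assume A(α) ≠ 0 for every α ∈ μ_{q+1}. Then f_c is linear equivalent to one of the following maps: (1) P0 : F_q × F_q → F_q × F_q, P0(x,y) = (x^{Q+1}, y^{Q+1}); (2) x ↦ x^{Q+1} on F_{q²}; (3) x ↦ x^{Q+q} on F_{q²}; (4) P1 : F_q × F_q → F_q × F_q, P1(x,y) = (x^{Q+1}, x·y^Q + y^{Q+1}); (5) P2(x,y) = (x^Q·y, x^{Q+1} + ε·y^{Q+1}) on F_q × F_q for some ε ∈ F_q^*; (6) P3(x,y) = (x^{Q+1} − x^Q·y, x·y^Q + ε·y^{Q+1}) on F_q × F_q for some ε ∈ F_q^* with ε ≠ −1; (7) x ↦ x^{Q+q} + ε·x^{Q+1} on F_{q²} for some ε ∈ F_{q²}^* with ε^{q+1} ≠ 1. -/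

import Mathlib

/-- A function between (additive groups of) finite abelian groups is planar if every
nonzero-direction derivative hits every value exactly once. -/
def IsPlanarFn {G H : Type*} [AddGroup G] [AddGroup H] (f : G → H) : Prop :=
  ∀ a : G, a ≠ 0 → ∀ b : H, ∃! x : G, f (x + a) - f x = b

/-- Linear equivalence of functions: `f = L1 ∘ g ∘ L2` for additive bijections `L1, L2`. -/
def LinEquivFn {V V' W W' : Type*} [AddGroup V] [AddGroup V'] [AddGroup W] [AddGroup W']
    (f : V → V') (g : W → W') : Prop :=
  ∃ (L1 : W' ≃+ V') (L2 : V ≃+ W), f = L1 ∘ g ∘ L2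

open Polynomial

theorem LinEquivFn.trans {U U' V V' W W' : Type*} [AddGroup U] [AddGroup U'] [AddGroup V]
    [AddGroup V'] [AddGroup W] [AddGroup W'] {f : U → U'} {g : V → V'} {h : W → W'}
    (hfg : LinEquivFn f g) (hgh : LinEquivFn g h) : LinEquivFn f h := by
  obtain ⟨L1, L2, rfl⟩ := hfg
  obtain ⟨M1, M2, rfl⟩ := hgh
  exact ⟨M1.trans L1, L2.trans M2, rfl⟩

/-- If `g` and `h` are intertwined by additive bijections, then they are linear equivalent. -/
theorem LinEquivFn.of_comp_eq {V V' W W' : Type*} [AddGroup V] [AddGroup V'] [AddGroup W]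
    [AddGroup W'] {g : V → V'} {h : W → W'} (L2 : W ≃+ V) (L1 : W' ≃+ V')
    (H : ∀ w, g (L2 w) = L1 (h w)) : LinEquivFn g h :=
  ⟨L1, L2.symm, by funext v; simp [← H]⟩

section SplitCase

variable {K : Type*} [Field K]

theorem exists_addEquiv_prod {a b c d : K} (h : a * d - b * c ≠ 0) :
    ∃ e : (K × K) ≃+ (K × K), ∀ x y, e (x, y) = (a * x + b * y, c * x + d * y) := by
  refine ⟨{ toFun := fun v => (a * v.1 + b * v.2, c * v.1 + d * v.2)
            invFun := fun v => ((d * v.1 - b * v.2) / (a * d - b * c),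
              (a * v.2 - c * v.1) / (a * d - b * c))
            left_inv := ?_
            right_inv := ?_
            map_add' := ?_ }, fun x y => rfl⟩
  · rintro ⟨x, y⟩
    ext <;> dsimp only <;> rw [div_eq_iff h] <;> ring
  · rintro ⟨x, y⟩
    ext <;> dsimp only <;> rw [mul_div_assoc', mul_div_assoc', ← add_div, div_eq_iff h] <;> ring
  · rintro ⟨x, y⟩ ⟨z, w⟩
    ext <;> simp <;> ring

/-- Invertible changes of coordinates in the source and in the target of a map `K² → K²`. -/
theorem LinEquivFn.change_coords {V V' : Type*} [AddGroup V] [AddGroup V'] {f : V → V'}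
    {g h : K × K → K × K} (hf : LinEquivFn f g) (a b c d r s t u : K)
    (hP : a * d - b * c ≠ 0) (hR : r * u - s * t ≠ 0)
    (H : ∀ x y, g (a * x + b * y, c * x + d * y) =
      (r * (h (x, y)).1 + s * (h (x, y)).2, t * (h (x, y)).1 + u * (h (x, y)).2)) :
    LinEquivFn f h := by
  obtain ⟨P, hP⟩ := exists_addEquiv_prod hP
  obtain ⟨R, hR⟩ := exists_addEquiv_prod hR
  refine hf.trans (.of_comp_eq P R ?_)
  rintro ⟨x, y⟩
  rw [hP, H, ← hR]

/-- The bilinear form with coefficients `n` composed with `φ` in its first argument. -/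
def sesqForm (φ : K →+* K) (n : Fin 4 → K) (x y z w : K) : K :=
  n 0 * φ x * z + n 1 * φ x * w + n 2 * φ y * z + n 3 * φ y * w

/-- The map `f` is linear equivalent to one of the normal forms on `K²`. -/
def HasSplitNormalForm {V V' : Type*} [AddGroup V] [AddGroup V'] (φ : K →+* K) (f : V → V') :
    Prop :=
  LinEquivFn f (fun v : K × K => (φ v.1 * v.1, φ v.2 * v.2))
  ∨ LinEquivFn f (fun v : K × K => (φ v.1 * v.1, v.1 * φ v.2 + φ v.2 * v.2))
  ∨ (∃ ε : K, ε ≠ 0 ∧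
      LinEquivFn f (fun v : K × K => (φ v.1 * v.2, φ v.1 * v.1 + ε * (φ v.2 * v.2))))
  ∨ (∃ ε : K, ε ≠ 0 ∧ ε ≠ -1 ∧
      LinEquivFn f (fun v : K × K =>
        (φ v.1 * v.1 - φ v.1 * v.2, v.1 * φ v.2 + ε * (φ v.2 * v.2))))

variable {V V' : Type*} [AddGroup V] [AddGroup V'] {f : V → V'} {φ : K →+* K}

theorem hasSplitNormalForm_of_fst_eq_norm (hφ : Function.Surjective φ) {n : Fin 4 → K}
    (hn : n 3 ≠ 0)
    (hf : LinEquivFn f (fun v : K × K => (φ v.1 * v.1, sesqForm φ n v.1 v.2 v.1 v.2))) :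
    HasSplitNormalForm φ f := by
  obtain ⟨u, hu⟩ := hφ (n 1 / n 3)
  obtain ⟨w, hw⟩ : ∃ w, n 2 = n 3 * w := ⟨n 2 / n 3, by field_simp⟩
  have hu' : n 1 = n 3 * φ u := by rw [hu]; field_simp
  by_cases huw : u = w
  · subst huw
    refine .inl (hf.change_coords 1 0 (-u) 1 1 0 (n 0 - n 3 * φ u * u) (n 3) (by simp)
      (by simpa using hn) fun x y => ?_)
    ext
    · simp
    · simp [sesqForm, hu', hw]; ring
  · have hs : w - u ≠ 0 := sub_ne_zero.2 (Ne.symm huw)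
    have hs' : φ (w - u) ≠ 0 := (map_ne_zero φ).2 hs
    refine .inr (.inl (hf.change_coords 1 0 (-u) (w - u) 1 0 (n 0 - n 3 * φ u * w)
      (n 3 * (φ (w - u) * (w - u))) (by simpa using hs) ?_ fun x y => ?_))
    · simp only [one_mul, zero_mul, sub_zero]; positivity
    · ext
      · simp
      · simp [sesqForm, hu', hw]; ring

theorem hasSplitNormalForm_of_fst_eq_mul (hφ : Function.Surjective φ) {n : Fin 4 → K}
    (hn₀ : n 0 ≠ 0) (hn₃ : n 3 ≠ 0)
    (hf : LinEquivFn f (fun v : K × K => (φ v.1 * v.2, sesqForm φ n v.1 v.2 v.1 v.2))) :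
    HasSplitNormalForm φ f := by
  by_cases hn₂ : n 2 = 0
  · refine .inr (.inr (.inl ⟨n 3 / n 0, div_ne_zero hn₃ hn₀,
      hf.change_coords 1 0 0 1 1 0 (n 1) (n 0) (by simp) (by simpa using hn₀) fun x y => ?_⟩))
    ext
    · simp
    · simp [sesqForm, hn₂]; field_simp; ring
  obtain ⟨u, hu⟩ := hφ (n 0 / n 2)
  have hu' : n 0 = φ u * n 2 := by rw [hu]; field_simp
  have hφu : φ u ≠ 0 := by rw [hu]; exact div_ne_zero hn₀ hn₂
  have hu₀ : u ≠ 0 := by rintro rfl; simp at hφu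
  by_cases h : n 2 = n 3 * u
  · refine .inr (.inl (hf.change_coords 0 (-1) u u 0 (-u) (φ u * n 3 * u)
      (-(n 1 - φ u * n 3) * u) (by simpa using hu₀) ?_ fun x y => ?_))
    · simp [hu₀, hφu, hn₃]
    · ext
      · simp; ring
      · simp [sesqForm, hu', h]; ring
  · have hs : n 2 - n 3 * u ≠ 0 := sub_ne_zero.2 h
    obtain ⟨ε, hε⟩ : ∃ ε, n 3 * u = ε * (n 2 - n 3 * u) :=
      ⟨n 3 * u / (n 2 - n 3 * u), (div_mul_cancel₀ _ hs).symm⟩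
    refine .inr (.inr (.inr ⟨ε, ?_, ?_,
      hf.change_coords 1 0 (-u) u (-u) 0 (-(n 1 - φ u * n 3) * u) (φ u * (n 2 - n 3 * u))
      (by simpa using hu₀) ?_ fun x y => ?_⟩))
    · rintro rfl
      simp [hn₃, hu₀] at hε
    · rintro rfl
      exact hn₂ (by linear_combination hε)
    · simp [hu₀, hφu, hs]
    · ext
      · simp; ring
      · simp [sesqForm, hu']
        linear_combination φ u * φ y * y * hε

theorem exists_factor_of_det_eq_zero (hφ : Function.Surjective φ) {m : Fin 4 → K}
    (hdet : m 0 * m 3 = m 1 * m 2) :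
    ∃ a b c d : K, m 0 = φ a * c ∧ m 1 = φ a * d ∧ m 2 = φ b * c ∧ m 3 = φ b * d := by
  by_cases h₀ : m 0 = 0
  · by_cases h₁ : m 1 = 0
    · exact ⟨0, 1, m 2, m 3, by simp [h₀, h₁]⟩
    · obtain ⟨b, hb⟩ := hφ (m 3 / m 1)
      have h₂ : m 2 = 0 := by simpa [h₀, h₁] using hdet.symm
      exact ⟨1, b, m 0, m 1, by simp [hb, h₀, h₁, h₂]⟩
  · obtain ⟨b, hb⟩ := hφ (m 2 / m 0)
    refine ⟨1, b, m 0, m 1, by simp, by simp, by simp [hb, h₀], ?_⟩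
    rw [hb]; field_simp; linear_combination hdet

/-- The coefficients of a sesquilinear form after a linear change of coordinates. -/
theorem exists_sesqForm_comp (φ : K →+* K) (n : Fin 4 → K) (a b c d : K) :
    ∃ n' : Fin 4 → K, n' 0 = sesqForm φ n a c a c ∧ n' 3 = sesqForm φ n b d b d ∧
      ∀ x y, sesqForm φ n (a * x + b * y) (c * x + d * y) (a * x + b * y) (c * x + d * y) =
        sesqForm φ n' x y x y := by
  refine ⟨![sesqForm φ n a c a c, sesqForm φ n a c b d, sesqForm φ n b d a c,
    sesqForm φ n b d b d], rfl, rfl, fun x y => ?_⟩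
  simp [sesqForm]; ring

theorem hasSplitNormalForm_of_det_eq_zero (hφ : Function.Surjective φ) {m n : Fin 4 → K}
    (hm : m ≠ 0) (hdet : m 0 * m 3 = m 1 * m 2)
    (haniso : ∀ x y, sesqForm φ m x y x y = 0 → sesqForm φ n x y x y = 0 → x = 0 ∧ y = 0)
    (hf : LinEquivFn f
      (fun v : K × K => (sesqForm φ m v.1 v.2 v.1 v.2, sesqForm φ n v.1 v.2 v.1 v.2))) :
    HasSplitNormalForm φ f := by
  obtain ⟨a, b, c, d, h₀, h₁, h₂, h₃⟩ := exists_factor_of_det_eq_zero hφ hdet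
  have hfac : ∀ x y, sesqForm φ m x y x y = φ (a * x + b * y) * (c * x + d * y) := fun x y => by
    simp [sesqForm, h₀, h₁, h₂, h₃]; ring
  have hab : ¬ (a = 0 ∧ b = 0) := by
    rintro ⟨rfl, rfl⟩
    exact hm (by ext i; fin_cases i <;> simp [h₀, h₁, h₂, h₃])
  have hcd : ¬ (c = 0 ∧ d = 0) := by
    rintro ⟨rfl, rfl⟩
    exact hm (by ext i; fin_cases i <;> simp [h₀, h₁, h₂, h₃])
  by_cases hΔ : a * d - b * c = 0
  · obtain ⟨e, e', he⟩ : ∃ e e', e * a + b * e' ≠ 0 := by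
      by_cases ha : a = 0
      · exact ⟨0, 1, by simpa using fun hb => hab ⟨ha, hb⟩⟩
      · exact ⟨1, 0, by simpa using ha⟩
    obtain ⟨κ, rfl, rfl⟩ : ∃ κ, c = κ * a ∧ d = κ * b := by
      refine ⟨(c * e + d * e') / (e * a + b * e'), ?_, ?_⟩ <;>
        rw [div_mul_eq_mul_div, eq_div_iff he]
      · linear_combination -e' * hΔ
      · linear_combination e * hΔ
    have hκ : κ ≠ 0 := by rintro rfl; simp at hcd
    obtain ⟨n', -, hn', hcomp⟩ := exists_sesqForm_comp φ n e (-b) e' a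
    refine hasSplitNormalForm_of_fst_eq_norm hφ (n := n') ?_
      (hf.change_coords e (-b) e' a (κ * (φ (e * a + b * e') * (e * a + b * e'))) 0 0 1
        (by simpa using he) ?_ fun x y => ?_)
    · rw [hn']
      intro h
      obtain ⟨hb, ha⟩ := haniso (-b) a (by rw [hfac]; ring) h
      exact hab ⟨ha, by simpa using hb⟩
    · have : φ (e * a + b * e') ≠ 0 := by rwa [Ne, map_eq_zero]
      simp only [mul_one, mul_zero, sub_zero]
      positivity
    · dsimp only
      rw [hcomp, hfac]
      ext
      · simp; ring
      · simp
  · obtain ⟨n', hn₀, hn₃, hcomp⟩ := exists_sesqForm_comp φ n d (-b) (-c) a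
    refine hasSplitNormalForm_of_fst_eq_mul hφ (n := n') ?_ ?_
      (hf.change_coords d (-b) (-c) a (φ (a * d - b * c) * (a * d - b * c)) 0 0 1
        (by convert hΔ using 1; ring) ?_ fun x y => ?_)
    · rw [hn₀]
      intro h
      obtain ⟨hd, hc⟩ := haniso d (-c) (by rw [hfac]; ring) h
      exact hcd ⟨by simpa using hc, hd⟩
    · rw [hn₃]
      intro h
      obtain ⟨hb, ha⟩ := haniso (-b) a (by rw [hfac]; ring_nf; simp) h
      exact hab ⟨ha, by simpa using hb⟩
    · have : φ (a * d - b * c) ≠ 0 := by rwa [Ne, map_eq_zero]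
      simp only [mul_one, mul_zero, sub_zero]
      positivity
    · dsimp only
      rw [hcomp, hfac]
      ext
      · simp; ring
      · simp

end SplitCase

section NonsplitCase

variable {K F : Type*} [Field K] [Field F]

/-- The map `f` is linear equivalent to one of the normal forms on the quadratic extension `F`
with conjugation `σ`. -/
def HasNonsplitNormalForm {V V' : Type*} [AddGroup V] [AddGroup V'] (σ ψ : F →+* F) (f : V → V') :
    Prop :=
  LinEquivFn f (fun z : F => ψ z * z)
  ∨ LinEquivFn f (fun z : F => ψ z * σ z)
  ∨ (∃ ε : F, ε ≠ 0 ∧ σ ε * ε ≠ 1 ∧ LinEquivFn f (fun z : F => ψ z * σ z + ε * (ψ z * z)))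

variable {V V' : Type*} [AddGroup V] [AddGroup V'] {f : V → V'} {ι : K →+* F} {σ : F →+* F}
  {φ : K →+* K} {ψ : F →+* F}

theorem det_conj_ne_zero (hfix : ∀ z, σ z = z → ∃ r, ι r = z) {a b : F}
    (hab : ∀ x y, a * ι x + b * ι y = 0 → x = 0 ∧ y = 0) : a * σ b - b * σ a ≠ 0 := by
  intro h
  have hb : b ≠ 0 := by
    rintro rfl
    simpa using hab 0 1
  obtain ⟨r, hr⟩ := hfix (a / b) (by
    rw [map_div₀, div_eq_div_iff (by simpa using hb) hb]
    linear_combination -h)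
  have := hab 1 (-r) (by simp [hr]; field_simp; ring)
  simp at this

theorem linEquivFn_mul_left {f g : F → F} {a : F} (ha : a ≠ 0) (H : ∀ z, f z = a * g z) :
    LinEquivFn f g :=
  .of_comp_eq (.refl F) { Equiv.mulLeft₀ a ha with map_add' := mul_add a } H

theorem eq_zero_of_sesquilinear_eq_zero {u v d₀ d₁ d₂ d₃ : F} (hu : σ u ≠ u) (hv : σ v ≠ v)
    (h₁₁ : d₀ + d₁ + d₂ + d₃ = 0) (h₁ᵥ : d₀ * σ v + d₁ * v + d₂ * σ v + d₃ * v = 0)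
    (hᵤ₁ : d₀ * σ u + d₁ * σ u + d₂ * u + d₃ * u = 0)
    (hᵤᵥ : d₀ * (σ u * σ v) + d₁ * (σ u * v) + d₂ * (u * σ v) + d₃ * (u * v) = 0) :
    d₀ = 0 ∧ d₁ = 0 ∧ d₂ = 0 ∧ d₃ = 0 := by
  rw [← sub_ne_zero] at hu hv
  have h₁ : d₁ + d₃ = 0 := by
    refine (mul_eq_zero.1 (?_ : (σ v - v) * (d₁ + d₃) = 0)).resolve_left hv
    linear_combination σ v * h₁₁ - h₁ᵥ
  have h₂ : d₁ * σ u + d₃ * u = 0 := by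
    refine (mul_eq_zero.1 (?_ : (σ v - v) * (d₁ * σ u + d₃ * u) = 0)).resolve_left hv
    linear_combination σ v * hᵤ₁ - hᵤᵥ
  have h₃ : d₁ = 0 := by
    refine (mul_eq_zero.1 (?_ : (σ u - u) * d₁ = 0)).resolve_left hu
    linear_combination h₂ - u * h₁
  have h₄ : d₀ = 0 := by
    refine (mul_eq_zero.1 (?_ : (σ u - u) * d₀ = 0)).resolve_left hu
    linear_combination hᵤ₁ - h₂ - u * (h₁₁ - h₁)
  subst h₃ h₄
  refine ⟨rfl, rfl, ?_, ?_⟩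
  · linear_combination h₁₁ - h₁
  · linear_combination h₁

variable [Fintype K] [Fintype F]

theorem exists_addEquiv_extension (hcard : Fintype.card F = Fintype.card K ^ 2)
    (hι : ∀ x, σ (ι x) = ι x) {a b : F} (hab : a * σ b - b * σ a ≠ 0) :
    ∃ e : (K × K) ≃+ F, ∀ x y, e (x, y) = a * ι x + b * ι y := by
  let g : K × K →+ F := AddMonoidHom.mk' (fun v => a * ι v.1 + b * ι v.2) fun v w => by
    simp; ring
  have hg : Function.Injective g := by
    rw [injective_iff_map_eq_zero]
    rintro ⟨x, y⟩ (h : a * ι x + b * ι y = 0)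
    have h' : σ a * ι x + σ b * ι y = 0 := by simpa [hι] using congrArg σ h
    have hx : (a * σ b - b * σ a) * ι x = 0 := by linear_combination σ b * h - b * h'
    have hy : (a * σ b - b * σ a) * ι y = 0 := by linear_combination a * h' - σ a * h
    simp only [mul_eq_zero, hab, false_or, map_eq_zero] at hx hy
    simp [hx, hy]
  have hbij := (Fintype.bijective_iff_injective_and_card g).2
    ⟨hg, by rw [Fintype.card_prod, hcard, sq]⟩
  exact ⟨AddEquiv.ofBijective g hbij, fun x y => rfl⟩

theorem hasNonsplitNormalForm_of_factor (hcard : Fintype.card F = Fintype.card K ^ 2)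
    (hι : ∀ x, σ (ι x) = ι x) (hfix : ∀ z, σ z = z → ∃ r, ι r = z) (hσ : ∀ z, σ (σ z) = z)
    {a b c d : F}
    (hab : ∀ x y, a * ι x + b * ι y = 0 → x = 0 ∧ y = 0)
    (hcd : ∀ x y, c * ι x + d * ι y = 0 → x = 0 ∧ y = 0)
    (hf : LinEquivFn f
      (fun v : K × K => ψ (a * ι v.1 + b * ι v.2) * (c * ι v.1 + d * ι v.2))) :
    HasNonsplitNormalForm σ ψ f := by
  have hab' := det_conj_ne_zero hfix hab
  have hcd' := det_conj_ne_zero hfix hcd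
  obtain ⟨s, t, rfl, rfl⟩ : ∃ s t, c = s * a + t * σ a ∧ d = s * b + t * σ b := by
    refine ⟨(c * σ b - d * σ a) / (a * σ b - b * σ a), (a * d - b * c) / (a * σ b - b * σ a),
      ?_, ?_⟩ <;> rw [div_mul_eq_mul_div, div_mul_eq_mul_div, ← add_div, eq_div_iff hab'] <;> ring
  have hst : σ s * s - σ t * t ≠ 0 := by
    contrapose! hcd'
    simp only [map_add, map_mul, hσ]
    linear_combination (a * σ b - b * σ a) * hcd'
  obtain ⟨e, he⟩ := exists_addEquiv_extension hcard hι hab'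
  have hf' : LinEquivFn f (fun z : F => ψ z * (s * z + t * σ z)) := by
    refine hf.trans (.of_comp_eq e.symm (.refl F) fun z => ?_)
    obtain ⟨⟨x, y⟩, rfl⟩ := e.surjective z
    rw [e.symm_apply_apply]
    simp only [AddEquiv.refl_apply, he, map_add, map_mul, hι]
    ring
  by_cases hs : s = 0
  · have ht : t ≠ 0 := by rintro rfl; simp [hs] at hst
    exact .inr (.inl (hf'.trans (linEquivFn_mul_left ht fun z => by simp [hs]; ring)))
  by_cases ht : t = 0
  · exact .inl (hf'.trans (linEquivFn_mul_left hs fun z => by simp [ht]; ring))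
  refine .inr (.inr ⟨s / t, div_ne_zero hs ht, ?_,
    hf'.trans (linEquivFn_mul_left ht fun z => by field_simp; ring)⟩)
  rw [map_div₀, div_mul_div_comm, Ne, div_eq_one_iff_eq (by simpa using ht)]
  exact sub_ne_zero.1 hst

theorem hasNonsplitNormalForm_of_det_eq_zero (hcard : Fintype.card F = Fintype.card K ^ 2)
    (hι : ∀ x, σ (ι x) = ι x) (hfix : ∀ z, σ z = z → ∃ r, ι r = z) (hσ : ∀ z, σ (σ z) = z)
    (hψ : Function.Surjective ψ) (hφψ : ∀ x, ψ (ι x) = ι (φ x)) {m n : Fin 4 → K} {θ : F}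
    (hθ : σ θ ≠ θ)
    (hdet : (θ * ι (m 0) + ι (n 0)) * (θ * ι (m 3) + ι (n 3)) =
      (θ * ι (m 1) + ι (n 1)) * (θ * ι (m 2) + ι (n 2)))
    (haniso : ∀ x y, sesqForm φ m x y x y = 0 → sesqForm φ n x y x y = 0 → x = 0 ∧ y = 0)
    (hf : LinEquivFn f
      (fun v : K × K => (sesqForm φ m v.1 v.2 v.1 v.2, sesqForm φ n v.1 v.2 v.1 v.2))) :
    HasNonsplitNormalForm σ ψ f := by
  obtain ⟨e, he⟩ := exists_addEquiv_extension (a := θ) (b := 1) hcard hι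
    (by simpa [sub_eq_zero] using hθ.symm)
  obtain ⟨a, b, c, d, h₀, h₁, h₂, h₃⟩ :=
    exists_factor_of_det_eq_zero hψ (m := fun i => θ * ι (m i) + ι (n i)) hdet
  have hfac : ∀ x y, e (sesqForm φ m x y x y, sesqForm φ n x y x y) =
      ψ (a * ι x + b * ι y) * (c * ι x + d * ι y) := fun x y => by
    simp only [he, sesqForm, map_add, map_mul, hφψ]
    linear_combination ι (φ x) * ι x * h₀ + ι (φ x) * ι y * h₁ + ι (φ y) * ι x * h₂
      + ι (φ y) * ι y * h₃
  have haniso' : ∀ x y, ψ (a * ι x + b * ι y) * (c * ι x + d * ι y) = 0 → x = 0 ∧ y = 0 := by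
    intro x y h
    rw [← hfac, map_eq_zero_iff e e.injective, Prod.mk_eq_zero] at h
    exact haniso x y h.1 h.2
  refine hasNonsplitNormalForm_of_factor hcard hι hfix hσ (a := a) (b := b) (c := c) (d := d)
    (fun x y h => haniso' x y (by simp [h])) (fun x y h => haniso' x y (by simp [h]))
    (hf.trans (.of_comp_eq (.refl _) e.symm fun v => ?_))
  rw [← hfac, e.symm_apply_apply]
  rfl

end NonsplitCase

section Classification

variable {K F : Type*} [Field K] [Field F] [Fintype K] [Fintype F]
  {V V' : Type*} [AddGroup V] [AddGroup V'] {f : V → V'} {ι : K →+* F} {σ : F →+* F}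
  {φ : K →+* K} {ψ : F →+* F}

theorem hasNormalForm_of_linearIndependent (hcard : Fintype.card F = Fintype.card K ^ 2)
    (hι : ∀ x, σ (ι x) = ι x) (hfix : ∀ z, σ z = z → ∃ r, ι r = z) (hσ : ∀ z, σ (σ z) = z)
    (hφ : Function.Surjective φ) (hψ : Function.Surjective ψ) (hφψ : ∀ x, ψ (ι x) = ι (φ x))
    (h2 : (2 : F) ≠ 0) (hsq : ∀ r, IsSquare (ι r)) {m n : Fin 4 → K}
    (hmn : ∀ α β : K, (∀ i, α * m i + β * n i = 0) → α = 0 ∧ β = 0)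
    (haniso : ∀ x y, sesqForm φ m x y x y = 0 → sesqForm φ n x y x y = 0 → x = 0 ∧ y = 0)
    (hf : LinEquivFn f
      (fun v : K × K => (sesqForm φ m v.1 v.2 v.1 v.2, sesqForm φ n v.1 v.2 v.1 v.2))) :
    HasSplitNormalForm φ f ∨ HasNonsplitNormalForm σ ψ f := by
  by_cases hm : m 0 * m 3 = m 1 * m 2
  · refine .inl (hasSplitNormalForm_of_det_eq_zero hφ ?_ hm haniso hf)
    rintro rfl
    simpa using hmn 1 0
  have hd : ι (m 0 * m 3 - m 1 * m 2) ≠ 0 := (map_ne_zero ι).2 (sub_ne_zero.2 hm)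
  obtain ⟨s, hs⟩ := hsq (discrim (m 0 * m 3 - m 1 * m 2)
    (m 0 * n 3 + n 0 * m 3 - m 1 * n 2 - n 1 * m 2) (n 0 * n 3 - n 1 * n 2))
  have : NeZero (2 : F) := ⟨h2⟩
  obtain ⟨θ, hθ⟩ := exists_quadratic_eq_zero
    (b := ι (m 0 * n 3 + n 0 * m 3 - m 1 * n 2 - n 1 * m 2)) (c := ι (n 0 * n 3 - n 1 * n 2))
    hd ⟨s, by rw [← hs]; simp only [discrim, map_sub, map_pow, map_mul, map_ofNat]⟩
  by_cases hfθ : σ θ = θ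
  · obtain ⟨r, rfl⟩ := hfix θ hfθ
    simp only [← map_mul, ← map_add, map_eq_zero] at hθ
    left
    have hform : ∀ x y, sesqForm φ (fun i => r * m i + n i) x y x y =
        r * sesqForm φ m x y x y + sesqForm φ n x y x y := fun x y => by
      simp [sesqForm]; ring
    refine hasSplitNormalForm_of_det_eq_zero hφ (m := fun i => r * m i + n i) (n := m) ?_
      (by linear_combination hθ) (fun x y h h' => haniso x y h' (by simpa [hform, h'] using h))
      (hf.change_coords 1 0 0 1 0 1 1 (-r) (by simp) (by simp) fun x y => ?_)
    · intro h
      simpa using hmn r 1 fun i => by simpa using congrFun h i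
    · ext <;> simp [hform]
  · refine .inr (hasNonsplitNormalForm_of_det_eq_zero hcard hι hfix hσ hψ hφψ hfθ ?_ haniso hf)
    simp only [map_add, map_sub, map_mul] at hθ
    linear_combination hθ

theorem hasNormalForm_of_quadrinomial (hcard : Fintype.card F = Fintype.card K ^ 2)
    (hι : ∀ x, σ (ι x) = ι x) (hfix : ∀ z, σ z = z → ∃ r, ι r = z) (hσ : ∀ z, σ (σ z) = z)
    (hφ : Function.Surjective φ) (hψ : Function.Surjective ψ) (hφψ : ∀ x, ψ (ι x) = ι (φ x))
    (hσψ : ∀ z, σ (ψ z) = ψ (σ z))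
    (h2 : (2 : F) ≠ 0) (hsq : ∀ r, IsSquare (ι r)) {c₀ c₁ c₂ c₃ : F} {f : F → F}
    (hf : ∀ z, f z = c₀ * (σ (ψ z) * σ z) + c₁ * (σ (ψ z) * z) + c₂ * (ψ z * σ z)
      + c₃ * (ψ z * z))
    (hc : ¬ ∃ lam, σ c₃ = lam * c₀ ∧ σ c₂ = lam * c₁ ∧ σ c₁ = lam * c₂ ∧ σ c₀ = lam * c₃)
    (hf₀ : ∀ z, f z = 0 → z = 0) :
    HasSplitNormalForm φ f ∨ HasNonsplitNormalForm σ ψ f := by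
  obtain ⟨w, hw⟩ : ∃ w, σ w ≠ w := by
    by_contra! h
    have := Fintype.card_le_of_surjective ι fun z => hfix z (h z)
    have := Fintype.one_lt_card (α := K)
    nlinarith
  have hψw : σ (ψ w) ≠ ψ w := by rw [hσψ]; exact ψ.injective.ne hw
  obtain ⟨e, he⟩ := exists_addEquiv_extension (a := 1) (b := w) hcard hι
    (by simpa [sub_eq_zero] using hw)
  have hcoef : ∀ z, ∃ m n, z = ι m + w * ι n := fun z => by
    obtain ⟨⟨m, n⟩, rfl⟩ := e.surjective z
    exact ⟨m, n, by simp [he]⟩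
  choose M N hMN using hcoef
  let C : Fin 4 → F := ![c₀ + c₁ + c₂ + c₃, c₀ * σ w + c₁ * w + c₂ * σ w + c₃ * w,
    c₀ * σ (ψ w) + c₁ * σ (ψ w) + c₂ * ψ w + c₃ * ψ w,
    c₀ * (σ (ψ w) * σ w) + c₁ * (σ (ψ w) * w) + c₂ * (ψ w * σ w) + c₃ * (ψ w * w)]
  have hfe : ∀ x y, f (e (x, y)) = e (sesqForm φ (fun i => M (C i)) x y x y,
      sesqForm φ (fun i => N (C i)) x y x y) := fun x y => by
    have h₀ := hMN (C 0)
    have h₁ := hMN (C 1)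
    have h₂ := hMN (C 2)
    have h₃ := hMN (C 3)
    nth_rw 1 [show C 0 = c₀ + c₁ + c₂ + c₃ from rfl] at h₀
    nth_rw 1 [show C 1 = c₀ * σ w + c₁ * w + c₂ * σ w + c₃ * w from rfl] at h₁
    nth_rw 1 [show C 2 = c₀ * σ (ψ w) + c₁ * σ (ψ w) + c₂ * ψ w + c₃ * ψ w from rfl] at h₂
    nth_rw 1 [show C 3 = c₀ * (σ (ψ w) * σ w) + c₁ * (σ (ψ w) * w) + c₂ * (ψ w * σ w)
      + c₃ * (ψ w * w) from rfl] at h₃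
    have h₀ := hMN (C 0)
    have h₁ := hMN (C 1)
    have h₂ := hMN (C 2)
    have h₃ := hMN (C 3)
    nth_rw 1 [show C 0 = c₀ + c₁ + c₂ + c₃ from rfl] at h₀
    nth_rw 1 [show C 1 = c₀ * σ w + c₁ * w + c₂ * σ w + c₃ * w from rfl] at h₁
    nth_rw 1 [show C 2 = c₀ * σ (ψ w) + c₁ * σ (ψ w) + c₂ * ψ w + c₃ * ψ w from rfl] at h₂
    nth_rw 1 [show C 3 = c₀ * (σ (ψ w) * σ w) + c₁ * (σ (ψ w) * w) + c₂ * (ψ w * σ w)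
      + c₃ * (ψ w * w) from rfl] at h₃
    rw [he, he, hf]
    simp only [sesqForm, map_add, map_mul, hι, hφψ, map_one]
    linear_combination ι (φ x) * ι x * h₀ + ι (φ x) * ι y * h₁ + ι (φ y) * ι x * h₂
      + ι (φ y) * ι y * h₃
  refine hasNormalForm_of_linearIndependent hcard hι hfix hσ hφ hψ hφψ h2 hsq
    (m := fun i => M (C i)) (n := fun i => N (C i)) ?_ (fun x y h h' => ?_)
    (.of_comp_eq e e fun ⟨x, y⟩ => hfe x y)
  · intro α β h
    by_contra hαβ
    have hδ : ι β - w * ι α ≠ 0 := fun h0 => hαβ <| by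
      have := (map_eq_zero_iff e e.injective (x := (β, -α))).1
        (by rw [he]; simpa [← sub_eq_add_neg] using h0)
      simpa [and_comm] using this
    have key : ∀ i, σ (ι β - w * ι α) * C i = (ι β - w * ι α) * σ (C i) := fun i => by
      have h' : ι α * ι (M (C i)) + ι β * ι (N (C i)) = 0 := by
        simp only [← map_mul, ← map_add, h i, map_zero]
      rw [hMN (C i)]
      simp only [map_sub, map_add, map_mul, hι]
      linear_combination (w - σ w) * h'
    generalize ι β - w * ι α = δ at hδ key
    have k₀ := key 0
    have k₁ := key 1
    have k₂ := key 2
    have k₃ := key 3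
    simp only [C, Matrix.cons_val, map_add, map_mul, hσ] at k₀ k₁ k₂ k₃
    obtain ⟨h₀, h₁, h₂, h₃⟩ := eq_zero_of_sesquilinear_eq_zero (σ := σ)
      (d₀ := σ δ * c₀ - δ * σ c₃) (d₁ := σ δ * c₁ - δ * σ c₂)
      (d₂ := σ δ * c₂ - δ * σ c₁) (d₃ := σ δ * c₃ - δ * σ c₀) hψw hw
      (by linear_combination k₀) (by linear_combination k₁) (by linear_combination k₂)
      (by linear_combination k₃)
    refine hc ⟨σ δ / δ, ?_, ?_, ?_, ?_⟩ <;> field_simp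
    · linear_combination -h₀
    · linear_combination -h₁
    · linear_combination -h₂
    · linear_combination -h₃
  · have := hf₀ (e (x, y)) (by rw [hfe, h, h']; exact map_zero e)
    simpa using this

end Classification

section FiniteFields

theorem exists_ringHom_of_card {p k : ℕ} [Fact p.Prime] {K F : Type*} [Field K]
    [Fintype K] [Field F] [Fintype F] [CharP K p] [CharP F p] {n : ℕ}
    (hK : Fintype.card K = p ^ k) (hF : Fintype.card F = p ^ n) (hkn : k ∣ n) :
    Nonempty (K →+* F) := by
  let := ZMod.algebra K p
  let := ZMod.algebra F p
  have hp := (Fact.out : p.Prime).two_le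
  have hK' : Module.finrank (ZMod p) K = k := by
    have := Module.card_eq_pow_finrank (K := ZMod p) (V := K)
    rw [hK, ZMod.card] at this
    exact (Nat.pow_right_injective hp this).symm
  have hF' : Module.finrank (ZMod p) F = n := by
    have := Module.card_eq_pow_finrank (K := ZMod p) (V := F)
    rw [hF, ZMod.card] at this
    exact (Nat.pow_right_injective hp this).symm
  obtain ⟨g⟩ := FiniteField.nonempty_algHom_of_finrank_dvd (F := ZMod p) (K := K) (L := F)
    (by rwa [hK', hF'])
  exact ⟨g⟩

theorem exists_of_pow_card_eq {K F : Type*} [Field K] [Fintype K] [Field F] (ι : K →+* F) {z : F}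
    (hz : z ^ Fintype.card K = z) : ∃ r, ι r = z := by
  classical
  have hne := FiniteField.X_pow_card_sub_X_ne_zero F (Fintype.one_lt_card (α := K))
  have hsub : Finset.univ.map ⟨ι, ι.injective⟩ ⊆
      (X ^ Fintype.card K - X : F[X]).roots.toFinset := by
    intro y hy
    obtain ⟨r, -, rfl⟩ := Finset.mem_map.1 hy
    simp [hne, ← map_pow, FiniteField.pow_card]
  have hcard : (X ^ Fintype.card K - X : F[X]).roots.toFinset.card ≤
      (Finset.univ.map ⟨ι, ι.injective⟩).card := by
    rw [Finset.card_map, Finset.card_univ]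
    refine (Multiset.toFinset_card_le _).trans ((Polynomial.card_roots' _).trans_eq ?_)
    exact FiniteField.X_pow_card_sub_X_natDegree_eq F (Fintype.one_lt_card (α := K))
  have hmem : z ∈ (X ^ Fintype.card K - X : F[X]).roots.toFinset := by
    simp [hne, hz]
  rw [← Finset.eq_of_subset_of_card_le hsub hcard] at hmem
  obtain ⟨r, -, rfl⟩ := Finset.mem_map.1 hmem
  exact ⟨r, rfl⟩

theorem isSquare_map_of_card {K F : Type*} [Field K] [Fintype K] [Field F] [Fintype F]
    (hcard : Fintype.card F = Fintype.card K ^ 2) (hodd : Odd (Fintype.card K)) (ι : K →+* F)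
    (r : K) : IsSquare (ι r) := by
  by_cases hr : r = 0
  · simp [hr]
  obtain ⟨m, hm⟩ := hodd
  have h2 : ringChar F ≠ 2 := by
    rw [Ne, FiniteField.even_card_iff_char_two, hcard, hm]
    have : (2 * m + 1) ^ 2 = 2 * (2 * m ^ 2 + 2 * m) + 1 := by ring
    omega
  rw [FiniteField.isSquare_iff h2 ((map_ne_zero ι).2 hr)]
  have h : Fintype.card F / 2 = (Fintype.card K - 1) * (m + 1) := by
    rw [hcard, hm, show (2 * m + 1) ^ 2 = 2 * (2 * m * (m + 1)) + 1 by ring,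
      Nat.add_sub_cancel]
    omega
  rw [h, ← map_pow, pow_mul, FiniteField.pow_card_sub_one_eq_one r hr, one_pow, map_one]

end FiniteFields

theorem stmt6 (p k ℓ : ℕ) (hp : p.Prime) (hodd : Odd p) (hk : 0 < k) (hl : 0 < ℓ)
    (q Q : ℕ) (hq : q = p ^ k) (hQ : Q = p ^ ℓ)
    (F K : Type) [Field F] [Fintype F] [Field K] [Fintype K]
    (hF : Fintype.card F = p ^ (2 * k)) (hK : Fintype.card K = p ^ k)
    (c0 c1 c2 c3 : F) (f : F → F)
    (hf : ∀ x : F, f x = c0 * x ^ (q * Q + q) + c1 * x ^ (q * Q + 1)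
        + c2 * x ^ (Q + q) + c3 * x ^ (Q + 1))
    (A B : Polynomial F)
    (hA : A = C c0 * X ^ (Q + 1) + C c1 * X ^ Q + C c2 * X + C c3)
    (hB : B = C (c3 ^ q) * X ^ (Q + 1) + C (c2 ^ q) * X ^ Q + C (c1 ^ q) * X + C (c0 ^ q))
    (hnonconst : ¬ ∃ lam : F, B = C lam * A)
    (hnoroot : ∀ α : F, α ^ (q + 1) = 1 → A.eval α ≠ 0) :
    LinEquivFn f (fun xy : K × K => (xy.1 ^ (Q + 1), xy.2 ^ (Q + 1)))
    ∨ LinEquivFn f (fun x : F => x ^ (Q + 1))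
    ∨ LinEquivFn f (fun x : F => x ^ (Q + q))
    ∨ LinEquivFn f (fun xy : K × K => (xy.1 ^ (Q + 1), xy.1 * xy.2 ^ Q + xy.2 ^ (Q + 1)))
    ∨ (∃ ε : K, ε ≠ 0 ∧
        LinEquivFn f (fun xy : K × K => (xy.1 ^ Q * xy.2, xy.1 ^ (Q + 1) + ε * xy.2 ^ (Q + 1))))
    ∨ (∃ ε : K, ε ≠ 0 ∧ ε ≠ -1 ∧
        LinEquivFn f (fun xy : K × K =>
          (xy.1 ^ (Q + 1) - xy.1 ^ Q * xy.2, xy.1 * xy.2 ^ Q + ε * xy.2 ^ (Q + 1))))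
    ∨ (∃ ε : F, ε ≠ 0 ∧ ε ^ (q + 1) ≠ 1 ∧
        LinEquivFn f (fun x : F => x ^ (Q + q) + ε * x ^ (Q + 1))) := by
  subst hq hQ
  have : Fact p.Prime := ⟨hp⟩
  have : CharP F p := charP_of_card_eq_prime_pow hF
  have : CharP K p := charP_of_card_eq_prime_pow hK
  have hcard : Fintype.card F = Fintype.card K ^ 2 := by rw [hF, hK, ← pow_mul, mul_comm]
  have hKodd : Odd (Fintype.card K) := hK ▸ hodd.pow
  obtain ⟨ι⟩ := exists_ringHom_of_card hK hF (dvd_mul_left k 2)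
  have h2 : (2 : F) ≠ 0 := by
    refine Ring.two_ne_zero fun h => ?_
    obtain rfl : p = 2 := by rw [← ringChar.eq F p, h]
    exact absurd hodd (by decide)
  have main := hasNormalForm_of_quadrinomial (ι := ι) (σ := iterateFrobenius F p k)
    (φ := iterateFrobenius K p ℓ) (ψ := iterateFrobenius F p ℓ) (f := f)
    (c₀ := c0) (c₁ := c1) (c₂ := c2) (c₃ := c3) hcard
    (fun x => by rw [iterateFrobenius_def, ← map_pow, ← hK, FiniteField.pow_card])
    (fun z hz => exists_of_pow_card_eq ι (by rwa [hK]))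
    (fun z => by
      simp only [iterateFrobenius_def]
      rw [← pow_mul, ← pow_add, ← two_mul, ← hF, FiniteField.pow_card])
    (Finite.surjective_of_injective (iterateFrobenius K p ℓ).injective)
    (Finite.surjective_of_injective (iterateFrobenius F p ℓ).injective)
    (fun x => by simp only [iterateFrobenius_def, map_pow])
    (fun z => by simp only [iterateFrobenius_def]; exact pow_right_comm _ _ _)
    h2 (isSquare_map_of_card hcard hKodd ι)
    (fun z => by rw [hf]; simp only [iterateFrobenius_def]; ring) ?_ ?_
  · revert main
    simp only [HasSplitNormalForm, HasNonsplitNormalForm, iterateFrobenius_def, ← pow_succ,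
      ← pow_add]
    rintro ((h | h | h | h) | (h | h | h)) <;> simp only [h, true_or, or_true]
  · rintro ⟨lam, h₀, h₁, h₂, h₃⟩
    simp only [iterateFrobenius_def] at h₀ h₁ h₂ h₃
    refine hnonconst ⟨lam, ?_⟩
    rw [hA, hB, h₀, h₁, h₂, h₃]
    simp only [C_mul]
    ring
  · intro z hz
    by_contra hz₀
    refine hnoroot (z ^ p ^ k / z) ?_ ?_
    · have hq : (z ^ p ^ k) ^ p ^ k = z := by
        rw [← pow_mul, ← pow_add, ← two_mul, ← hF, FiniteField.pow_card]
      rw [div_pow, div_eq_one_iff_eq (pow_ne_zero _ hz₀), pow_succ, hq, pow_succ, mul_comm]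
    · have hpow : z ^ p ^ ℓ ≠ 0 := pow_ne_zero _ hz₀
      refine (mul_eq_zero.1 (?_ : _ * (z ^ p ^ ℓ * z) = 0)).resolve_right (mul_ne_zero hpow hz₀)
      rw [← hz, hf, hA]
      simp only [eval_add, eval_mul, eval_C, eval_pow, eval_X, div_pow, pow_succ]
      field_simp
      ring
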